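/- Let μ and p satisfy assumption (H1) and assume μ((0,1]) > 0. For each integer N ≥ 1 set α_{−,N} = ∫_{(0,1]} z(1−e^{−Nz}) μ(dz), q₀^{−,N} = (Nα_{−,N})^{−1}∫_{(0,1]}(e^{−Nz}−1+Nz)μ(dz), q₁^{−,N} = 0, and q_k^{−,N} = (k!·Nα_{−,N})^{−1}∫_{(0,1]}(Nz)^k e^{−Nz} μ(dz) for k ≥ 2. Then there exists a constant C₃ > 0 (depending only on ∫_{(0,1]} z² μ(dz)) such that for all integers N ≥ 1: N α_{−,N} · Σ_{k≥0} ((k−1)/N)² q_k^{−,N} ≤ C₃. -/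

import Mathlib

open Real Set MeasureTheory

/-- The Poisson-type weights `x ^ k * exp (-x) / k!` for `k ≥ 2`, with the mass of `k = 1` removed
and the mass of `k = 0` adjusted so that the first moment about `1` vanishes. -/
noncomputable def truncatedPoissonWeight (x : ℝ) : ℕ → ℝ
  | 0 => Real.exp (-x) - 1 + x
  | 1 => 0
  | k + 2 => x ^ (k + 2) * Real.exp (-x) / ((k + 2).factorial : ℝ)

lemma truncatedPoissonWeight_nonneg {x : ℝ} (hx : 0 ≤ x) (k : ℕ) :
    0 ≤ truncatedPoissonWeight x k := by
  match k with
  | 0 =>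
    have := Real.add_one_le_exp (-x)
    simp only [truncatedPoissonWeight]
    linarith
  | 1 => exact le_rfl
  | k + 2 =>
    simp only [truncatedPoissonWeight]
    positivity

lemma continuous_truncatedPoissonWeight (k : ℕ) :
    Continuous fun x : ℝ => truncatedPoissonWeight x k := by
  match k with
  | 0 => simp only [truncatedPoissonWeight]; fun_prop
  | 1 => simp only [truncatedPoissonWeight]; fun_prop
  | k + 2 => simp only [truncatedPoissonWeight]; fun_prop

lemma exp_neg_sub_one_add_le_sq {x : ℝ} (hx : 0 ≤ x) : Real.exp (-x) - 1 + x ≤ x ^ 2 := by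
  rcases le_total x 1 with h | h
  · have := Real.abs_exp_sub_one_sub_id_le (x := -x) (by rw [abs_neg, abs_of_nonneg hx]; exact h)
    have := (abs_le.1 this).2
    linarith [neg_sq x]
  · have : Real.exp (-x) ≤ 1 := Real.exp_le_one_iff.2 (by linarith)
    nlinarith

lemma sq_sub_one_mul_truncatedPoissonWeight_le {x : ℝ} (hx : 0 ≤ x) (k : ℕ) :
    (((k + 2 : ℕ) : ℝ) - 1) ^ 2 * truncatedPoissonWeight x (k + 2) ≤
      x ^ 2 * Real.exp (-x) * (x ^ k / (k.factorial : ℝ)) := by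
  have hk : (0 : ℝ) < (k.factorial : ℝ) := by positivity
  have hratio : ((k : ℝ) + 1) / (k + 2) ≤ 1 := by
    rw [div_le_one (by positivity)]
    linarith
  calc (((k + 2 : ℕ) : ℝ) - 1) ^ 2 * truncatedPoissonWeight x (k + 2)
      = x ^ 2 * Real.exp (-x) * (x ^ k / (k.factorial : ℝ)) * (((k : ℝ) + 1) / (k + 2)) := by
        simp only [truncatedPoissonWeight, Nat.factorial_succ]
        push_cast
        field_simp
        ring
    _ ≤ _ := mul_le_of_le_one_right (by positivity) hratio

/-- Partial sums of the second moment about `1` are at most `2 * x ^ 2`. -/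
lemma sum_range_sq_sub_one_mul_truncatedPoissonWeight_le {x : ℝ} (hx : 0 ≤ x) (n : ℕ) :
    ∑ k ∈ Finset.range n, ((k : ℝ) - 1) ^ 2 * truncatedPoissonWeight x k ≤ 2 * x ^ 2 := by
  calc ∑ k ∈ Finset.range n, ((k : ℝ) - 1) ^ 2 * truncatedPoissonWeight x k
      ≤ ∑ k ∈ Finset.range (n + 2), ((k : ℝ) - 1) ^ 2 * truncatedPoissonWeight x k :=
        Finset.sum_le_sum_of_subset_of_nonneg (Finset.range_mono (by omega)) fun k _ _ =>
          mul_nonneg (sq_nonneg _) (truncatedPoissonWeight_nonneg hx k)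
    _ = ∑ k ∈ Finset.range n,
          (((k + 2 : ℕ) : ℝ) - 1) ^ 2 * truncatedPoissonWeight x (k + 2) +
          (Real.exp (-x) - 1 + x) := by
        rw [Finset.sum_range_succ', Finset.sum_range_succ']
        norm_num [truncatedPoissonWeight, add_sub_assoc]
    _ ≤ ∑ k ∈ Finset.range n, x ^ 2 * Real.exp (-x) * (x ^ k / (k.factorial : ℝ)) + x ^ 2 :=
        add_le_add (Finset.sum_le_sum fun k _ => sq_sub_one_mul_truncatedPoissonWeight_le hx k)
          (exp_neg_sub_one_add_le_sq hx)
    _ ≤ x ^ 2 * Real.exp (-x) * Real.exp x + x ^ 2 := by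
        rw [← Finset.mul_sum]
        gcongr
        exact Real.sum_le_exp_of_nonneg hx n
    _ = 2 * x ^ 2 := by
        rw [mul_assoc, ← Real.exp_add]
        simp
        ring

lemma integrableOn_sq_Ioc_of_integrableOn_min {μ : Measure ℝ} {p : ℝ} (hp : p ≤ 2)
    (hμ : IntegrableOn (fun z : ℝ => min (z ^ p) (z ^ 2)) (Ioi 0) μ) :
    IntegrableOn (fun z : ℝ => z ^ 2) (Ioc 0 1) μ := by
  refine (hμ.mono_set Ioc_subset_Ioi_self).congr_fun (fun z hz => min_eq_right ?_)
    measurableSet_Ioc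
  rw [← Real.rpow_natCast]
  exact Real.rpow_le_rpow_of_exponent_ge hz.1 hz.2 (by simpa using hp)

/-- Integrated form of the second moment bound, for the weights at `c * z`. -/
lemma sum_range_integral_truncatedPoissonWeight_le {μ : Measure ℝ} {c : ℝ} (hc : 0 ≤ c)
    (hμ : IntegrableOn (fun z : ℝ => z ^ 2) (Ioc 0 1) μ) (n : ℕ) :
    ∑ k ∈ Finset.range n,
      ((k : ℝ) - 1) ^ 2 * ∫ z in Ioc (0 : ℝ) 1, truncatedPoissonWeight (c * z) k ∂μ ≤
      c ^ 2 * (2 * ∫ z in Ioc (0 : ℝ) 1, z ^ 2 ∂μ) := by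
  have hdom : IntegrableOn (fun z : ℝ => 2 * (c * z) ^ 2) (Ioc 0 1) μ := by
    simp only [mul_pow]
    exact (Integrable.const_mul hμ _).const_mul _
  have hint (k : ℕ) : IntegrableOn
      (fun z : ℝ => ((k : ℝ) - 1) ^ 2 * truncatedPoissonWeight (c * z) k) (Ioc 0 1) μ := by
    refine Integrable.mono' hdom ?_ ?_
    · exact (continuous_const.mul ((continuous_truncatedPoissonWeight k).comp
        (continuous_const_mul c))).aestronglyMeasurable
    · refine (ae_restrict_mem measurableSet_Ioc).mono fun z hz => ?_
      have hx : 0 ≤ c * z := mul_nonneg hc hz.1.le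
      have hnonneg (j : ℕ) : 0 ≤ ((j : ℝ) - 1) ^ 2 * truncatedPoissonWeight (c * z) j :=
        mul_nonneg (sq_nonneg _) (truncatedPoissonWeight_nonneg hx j)
      rw [Real.norm_of_nonneg (hnonneg k)]
      exact (Finset.single_le_sum (f := fun j : ℕ =>
          ((j : ℝ) - 1) ^ 2 * truncatedPoissonWeight (c * z) j)
        (fun j _ => hnonneg j) (Finset.self_mem_range_succ k)).trans
        (sum_range_sq_sub_one_mul_truncatedPoissonWeight_le hx (k + 1))
  calc _ = ∫ z in Ioc (0 : ℝ) 1, ∑ k ∈ Finset.range n,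
          ((k : ℝ) - 1) ^ 2 * truncatedPoissonWeight (c * z) k ∂μ := by
        rw [integral_finsetSum _ fun k _ => hint k]
        simp only [integral_const_mul]
    _ ≤ ∫ z in Ioc (0 : ℝ) 1, 2 * (c * z) ^ 2 ∂μ :=
        setIntegral_mono_on (integrable_finsetSum _ fun k _ => hint k) hdom measurableSet_Ioc
          fun z hz => sum_range_sq_sub_one_mul_truncatedPoissonWeight_le
            (mul_nonneg hc hz.1.le) n
    _ = _ := by
        simp only [mul_pow, integral_const_mul]
        ring

/-- Under assumption (H1) with `μ((0,1]) > 0`, the scaled second moments about 1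
of the distributions `(q_k^{−,N})` are bounded uniformly in `N`. -/
theorem stmt9 (μ : Measure ℝ) [SigmaFinite μ] (p : ℝ) (hp1 : 1 < p) (hp2 : p < 2)
    (hμ : IntegrableOn (fun z : ℝ => min (z ^ p) (z ^ 2)) (Ioi 0) μ)
    (hpos : 0 < μ (Ioc 0 1))
    (α : ℕ → ℝ)
    (hα : ∀ N : ℕ, α N = ∫ z in Ioc (0 : ℝ) 1, z * (1 - Real.exp (-(N : ℝ) * z)) ∂μ)
    (q : ℕ → ℕ → ℝ)
    (hq0 : ∀ N : ℕ, q N 0 = ((N : ℝ) * α N)⁻¹ *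
      ∫ z in Ioc (0 : ℝ) 1, (Real.exp (-(N : ℝ) * z) - 1 + (N : ℝ) * z) ∂μ)
    (hq1 : ∀ N : ℕ, q N 1 = 0)
    (hqk : ∀ N k : ℕ, 2 ≤ k → q N k = ((k.factorial : ℝ) * ((N : ℝ) * α N))⁻¹ *
      ∫ z in Ioc (0 : ℝ) 1, ((N : ℝ) * z) ^ k * Real.exp (-(N : ℝ) * z) ∂μ) :
    ∃ C₃ : ℝ, 0 < C₃ ∧ ∀ N : ℕ, 1 ≤ N →
      (N : ℝ) * α N * ∑' k : ℕ, (((k : ℝ) - 1) / N) ^ 2 * q N k ≤ C₃ := by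
  have hsq := integrableOn_sq_Ioc_of_integrableOn_min hp2.le hμ
  have hI : 0 ≤ ∫ z in Ioc (0 : ℝ) 1, z ^ 2 ∂μ := integral_nonneg fun z => sq_nonneg z
  refine ⟨2 * (∫ z in Ioc (0 : ℝ) 1, z ^ 2 ∂μ) + 1, by positivity, fun N hN => ?_⟩
  have hN0 : (0 : ℝ) < N := by exact_mod_cast hN
  rcases eq_or_ne ((N : ℝ) * α N) 0 with hA | hA
  · rw [hA, zero_mul]
    positivity
  have hweight (k : ℕ) : (N : ℝ) * α N * q N k =
      ∫ z in Ioc (0 : ℝ) 1, truncatedPoissonWeight ((N : ℝ) * z) k ∂μ := by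
    match k with
    | 0 =>
      rw [hq0, mul_inv_cancel_left₀ hA]
      simp only [truncatedPoissonWeight, neg_mul]
    | 1 => simp [hq1, truncatedPoissonWeight]
    | k + 2 =>
      rw [hqk N (k + 2) (by omega), mul_inv, mul_comm _ ((N : ℝ) * α N)⁻¹,
        mul_assoc _⁻¹, mul_inv_cancel_left₀ hA]
      simp only [truncatedPoissonWeight, neg_mul, integral_div]
      rw [inv_mul_eq_div]
  have hterm (k : ℕ) : (N : ℝ) * α N * ((((k : ℝ) - 1) / N) ^ 2 * q N k) =
      ((k : ℝ) - 1) ^ 2 * (∫ z in Ioc (0 : ℝ) 1, truncatedPoissonWeight ((N : ℝ) * z) k ∂μ) /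
        (N : ℝ) ^ 2 := by
    rw [← hweight, div_pow]
    ring
  rw [← tsum_mul_left]
  simp only [hterm]
  refine (Real.tsum_le_of_sum_range_le (fun k => ?_) fun n => ?_).trans (le_add_of_nonneg_right
    zero_le_one)
  · exact div_nonneg (mul_nonneg (sq_nonneg _) (setIntegral_nonneg measurableSet_Ioc fun z hz =>
      truncatedPoissonWeight_nonneg (mul_nonneg hN0.le hz.1.le) k)) (sq_nonneg _)
  · rw [← Finset.sum_div, div_le_iff₀' (by positivity)]
    exact sum_range_integral_truncatedPoissonWeight_le hN0.le hsq n
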